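/- Let T > 0, I = [−T,T], and let h : I → ℝ be integrable with h(t) > 0 for a.e. t ∈ I. For i = 1, 2, let u_i be the unique absolutely continuous solution of x'(t) + m_i·x(−t) = h(t) a.e. on I with x(−T) = x(T). Then: (1) if 0 < m₁ < m₂ ≤ π/(4T), then u₁(t) > u₂(t) for all t ∈ I and Ḡ_{m₁}(t,s) > Ḡ_{m₂}(t,s) for all t, s ∈ I; (2) if −π/(4T) ≤ m₁ < m₂ < 0, then u₁(t) > u₂(t) for all t ∈ I and Ḡ_{m₁}(t,s) > Ḡ_{m₂}(t,s) for all t, s ∈ I. -/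

import Mathlib

open MeasureTheory

/-- The Green's function `Ḡ_m` of the periodic problem
`x'(t) + m·x(−t) = h(t)` on `[−T,T]`, `x(−T) = x(T)`, defined by
`2·sin(mT)·Ḡ_m(t,s) = cos(m(T−s−t)) + sin(m(T+s−t))` if `−t ≤ s < t`;
`cos(m(T−s−t)) − sin(m(T−s+t))` if `−s ≤ t < s`;
`cos(m(T+s+t)) + sin(m(T+s−t))` if `s < −|t|`;
`cos(m(T+s+t)) − sin(m(T−s+t))` if `t < −|s|`; and on the diagonal by
`cos(m(T−2t)) − sin(mT)` if `m > 0` and `cos(m(T−2t)) + sin(mT)` if `m < 0`. -/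
noncomputable def Gbar (T m t s : ℝ) : ℝ :=
  (if -t ≤ s ∧ s < t then Real.cos (m * (T - s - t)) + Real.sin (m * (T + s - t))
   else if -s ≤ t ∧ t < s then Real.cos (m * (T - s - t)) - Real.sin (m * (T - s + t))
   else if s < -|t| then Real.cos (m * (T + s + t)) + Real.sin (m * (T + s - t))
   else if t < -|s| then Real.cos (m * (T + s + t)) - Real.sin (m * (T - s + t))
   else if 0 < m then Real.cos (m * (T - 2 * t)) - Real.sin (m * T)
   else Real.cos (m * (T - 2 * t)) + Real.sin (m * T)) /
    (2 * Real.sin (m * T))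

/-- `x` is an absolutely continuous solution of `x'(t) + m·x(−t) = h(t)` a.e.
on `I = [−T,T]` with `x(−T) = x(T)`. -/
def IsSol (T m : ℝ) (h x : ℝ → ℝ) : Prop :=
  (∃ g : ℝ → ℝ, IntegrableOn g (Set.Icc (-T) T) ∧
    (∀ t ∈ Set.Icc (-T) T, x t = x (-T) + ∫ s in (-T)..t, g s) ∧
    (∀ᵐ t ∂(volume.restrict (Set.Icc (-T) T)), g t + m * x (-t) = h t)) ∧
  x (-T) = x T

/-- Product rule in integrated form. -/
theorem aux_prod {T a b : ℝ} {g x φ φ' : ℝ → ℝ} (hg : IntegrableOn g (Set.Icc (-T) T))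
    (hx : ∀ t ∈ Set.Icc (-T) T, x t = x (-T) + ∫ s in (-T)..t, g s)
    (ha : -T ≤ a) (hab : a ≤ b) (hb : b ≤ T)
    (hφ : ∀ t, HasDerivAt φ (φ' t) t) (hφ' : Continuous φ') :
    IntervalIntegrable (fun t => g t * φ t + x t * φ' t) volume a b ∧
    ∫ t in a..b, (g t * φ t + x t * φ' t) = x b * φ b - x a * φ a := by
  have hTT : -T ≤ T := by linarith
  have hgi : IntervalIntegrable g volume (-T) T := by
    rw [intervalIntegrable_iff_integrableOn_Icc_of_le hTT]; exact hg
  set X : ℝ → ℝ := fun t => x (-T) + ∫ s in (-T)..t, g s with hX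
  have hsub : Set.uIcc a b ⊆ Set.uIcc (-T) T := by
    rw [Set.uIcc_of_le hab, Set.uIcc_of_le hTT]; exact Set.Icc_subset_Icc ha hb
  have hac0 : AbsolutelyContinuousOnInterval (fun t => ∫ s in (-T)..t, g s) (-T) T :=
    hgi.absolutelyContinuousOnInterval_intervalIntegral (c := -T) (by simp)
  have hc : AbsolutelyContinuousOnInterval (fun _ : ℝ => x (-T)) (-T) T :=
    contDiffOn_const.absolutelyContinuousOnInterval
  have hac : AbsolutelyContinuousOnInterval X a b := (hc.add hac0).mono hsub
  have hφc : ContDiff ℝ 1 φ := by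
    rw [contDiff_one_iff_deriv]
    refine ⟨fun t => (hφ t).differentiableAt, ?_⟩
    have : deriv φ = φ' := funext fun t => (hφ t).deriv
    rw [this]; exact hφ'
  have hφac : AbsolutelyContinuousOnInterval φ a b :=
    hφc.contDiffOn.absolutelyContinuousOnInterval
  have key := hac.integral_deriv_mul_eq_sub hφac
  have hgab : IntervalIntegrable g volume a b := hgi.mono_set hsub
  have hXx : ∀ t ∈ Set.Icc a b, X t = x t := fun t ht =>
    (hx t ⟨ha.trans ht.1, ht.2.trans hb⟩).symm
  have hae : ∀ᵐ t, t ∈ Set.uIoc a b →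
      deriv X t * φ t + X t * deriv φ t = g t * φ t + x t * φ' t := by
    filter_upwards [hgi.ae_hasDerivAt_integral] with t ht htab
    have h1 : t ∈ Set.uIcc a b := Set.uIoc_subset_uIcc htab
    have h2 := (ht (hsub h1) (-T) (by simp)).const_add (x (-T))
    have h3 : deriv X t = g t := h2.deriv
    rw [Set.uIcc_of_le hab] at h1
    rw [h3, hXx t h1, (hφ t).deriv]
  constructor
  · have hint : IntervalIntegrable (fun t => g t * φ t + X t * φ' t) volume a b :=
      (hgab.mul_continuousOn hφc.continuous.continuousOn).add
        ((hac.continuousOn.mul hφ'.continuousOn).intervalIntegrable)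
    refine hint.congr ?_
    intro t ht
    rw [Set.uIoc_of_le hab] at ht
    simp only [hXx t ⟨ht.1.le, ht.2⟩]
  · rw [← intervalIntegral.integral_congr_ae hae, key, hXx b ⟨hab, le_rfl⟩, hXx a ⟨le_rfl, hab⟩]

theorem aux_neg_ae {T : ℝ} {p : ℝ → Prop}
    (hp : ∀ᵐ t ∂(volume.restrict (Set.Icc (-T) T)), p t) :
    ∀ᵐ t ∂(volume.restrict (Set.Icc (-T) T)), p (-t) := by
  rw [ae_restrict_iff' measurableSet_Icc] at hp ⊢
  have := (Measure.measurePreserving_neg (volume : Measure ℝ)).quasiMeasurePreserving.ae hp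
  filter_upwards [this] with t ht h2
  exact ht ⟨by linarith [h2.2], by linarith [h2.1]⟩

theorem aux_neg_prim {T : ℝ} (hT : 0 < T) {g x : ℝ → ℝ} (hg : IntegrableOn g (Set.Icc (-T) T))
    (hx : ∀ t ∈ Set.Icc (-T) T, x t = x (-T) + ∫ s in (-T)..t, g s) :
    IntegrableOn (fun t => - g (-t)) (Set.Icc (-T) T) ∧
    ∀ t ∈ Set.Icc (-T) T, x (-t) = x (-(-T)) + ∫ s in (-T)..t, - g (-s) := by
  have hTT : -T ≤ T := by linarith
  have hgi : IntervalIntegrable g volume (-T) T := by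
    rw [intervalIntegrable_iff_integrableOn_Icc_of_le hTT]; exact hg
  constructor
  · rw [← intervalIntegrable_iff_integrableOn_Icc_of_le hTT]
    have := (hgi.comp_sub_left 0).neg.symm
    simpa [Function.comp_def, Pi.neg_def] using this
  · intro t ht
    have h1 : IntervalIntegrable g volume (-T) (-t) := by
      refine hgi.mono_set ?_
      rw [Set.uIcc_of_le hTT, Set.uIcc_of_le (by linarith [ht.2])]
      exact Set.Icc_subset_Icc le_rfl (by linarith [ht.1])
    have h2 : IntervalIntegrable g volume (-t) T := by
      refine hgi.mono_set ?_
      rw [Set.uIcc_of_le hTT, Set.uIcc_of_le (by linarith [ht.1])]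
      exact Set.Icc_subset_Icc (by linarith [ht.2]) le_rfl
    rw [intervalIntegral.integral_neg, intervalIntegral.integral_comp_neg, neg_neg,
      hx T ⟨hTT, le_rfl⟩, hx (-t) ⟨by linarith [ht.2], by linarith [ht.1]⟩,
      ← intervalIntegral.integral_add_adjacent_intervals h1 h2]
    ring

theorem aux_pos_int {a b : ℝ} (hab : a < b) {f : ℝ → ℝ} (hf : IntervalIntegrable f volume a b)
    (hpos : ∀ᵐ t, t ∈ Set.Ioc a b → 0 < f t) : 0 < ∫ t in a..b, f t := by
  have hpos' : ∀ᵐ t ∂(volume.restrict (Set.Ioc a b)), 0 < f t :=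
    (ae_restrict_iff' measurableSet_Ioc).2 hpos
  rw [intervalIntegral.integral_of_le hab.le]
  rw [intervalIntegrable_iff_integrableOn_Ioc_of_le hab.le] at hf
  rw [integral_pos_iff_support_of_nonneg_ae (hpos'.mono fun t ht => ht.le) hf]
  have : (Function.support f) =ᵐ[volume.restrict (Set.Ioc a b)] Set.univ := by
    filter_upwards [hpos'] with t ht
    exact propext ⟨fun _ => trivial, fun _ => ht.ne'⟩
  rw [measure_congr this]
  simp [hab]

theorem aux_pos {T m : ℝ} (hT : 0 < T) (hm : 0 < m) (hmT : m * T ≤ Real.pi / 4)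
    {h x : ℝ → ℝ} (hpos : ∀ᵐ t ∂(volume.restrict (Set.Icc (-T) T)), 0 < h t)
    (hx : IsSol T m h x) : ∀ t ∈ Set.Icc (-T) T, 0 < x t := by
  obtain ⟨⟨g, hg, hxg, heq⟩, hper⟩ := hx
  obtain ⟨hg', hxg'⟩ := aux_neg_prim hT hg hxg
  have hpos' := aux_neg_ae hpos
  have heq' := aux_neg_ae heq
  have hpi := Real.pi_pos
  -- trigonometric facts
  have hS : ∀ t, 0 < t → t ≤ T → 0 < Real.sin (m * t) := fun t h0 h1 =>
    Real.sin_pos_of_pos_of_lt_pi (by positivity) (by nlinarith)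
  have hC : ∀ t, 0 ≤ t → t ≤ T → 0 < Real.cos (m * t) := fun t h0 h1 =>
    Real.cos_pos_of_mem_Ioo ⟨by nlinarith [mul_nonneg hm.le h0], by nlinarith⟩
  have hCS : ∀ t, 0 ≤ t → t ≤ T → Real.sin (m * t) ≤ Real.cos (m * t) := by
    intro t h0 h1
    rw [← Real.cos_pi_div_two_sub]
    have : m * t ≤ m * T := by nlinarith
    exact Real.cos_le_cos_of_nonneg_of_le_pi (by nlinarith [mul_nonneg hm.le h0])
      (by nlinarith [mul_nonneg hm.le h0]) (by linarith)
  have hdc : ∀ t, HasDerivAt (fun t => Real.cos (m * t)) (-(m * Real.sin (m * t))) t := by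
    intro t
    have := ((hasDerivAt_id t).const_mul m).cos
    convert! this using 1
    simp; ring
  have hds : ∀ t, HasDerivAt (fun t => Real.sin (m * t)) (m * Real.cos (m * t)) t := by
    intro t
    have := ((hasDerivAt_id t).const_mul m).sin
    convert! this using 1
    simp; ring
  have hcc : Continuous (fun t => -(m * Real.sin (m * t))) := by fun_prop
  have hcs : Continuous (fun t => m * Real.cos (m * t)) := by fun_prop
  set P : ℝ → ℝ := fun t => x (-t) * Real.cos (m * t) - x t * Real.sin (m * t) with hP
  set Q : ℝ → ℝ := fun t => x t * Real.cos (m * t) + x (-t) * Real.sin (m * t) with hQ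
  have hall : ∀ᵐ t, t ∈ Set.Icc (-T) T → 0 < h t ∧ 0 < h (-t) ∧ g t + m * x (-t) = h t ∧
      g (-t) + m * x (-(-t)) = h (-t) := by
    rw [← ae_restrict_iff' measurableSet_Icc]
    filter_upwards [hpos, hpos', heq, heq'] with t h1 h2 h3 h4
    exact ⟨h1, h2, h3, h4⟩
  have main : ∀ a b, 0 ≤ a → a < b → b ≤ T → P b < P a ∧ Q a - P a < Q b - P b := by
    intro a b ha hab hb
    have ha' : -T ≤ a := by linarith
    obtain ⟨i1, e1⟩ := aux_prod hg hxg ha' hab.le hb hdc hcc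
    obtain ⟨i2, e2⟩ := aux_prod hg hxg ha' hab.le hb hds hcs
    obtain ⟨i3, e3⟩ := aux_prod (x := fun t => x (-t)) hg' hxg' ha' hab.le hb hdc hcc
    obtain ⟨i4, e4⟩ := aux_prod (x := fun t => x (-t)) hg' hxg' ha' hab.le hb hds hcs
    constructor
    · have := aux_pos_int hab (i2.sub i3) (by
        filter_upwards [hall] with t ht hab'
        have t0 : 0 < t := lt_of_le_of_lt ha hab'.1
        have t1 : t ≤ T := hab'.2.trans hb
        obtain ⟨h1, h2, h3, h4⟩ := ht ⟨by linarith, t1⟩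
        rw [neg_neg] at h4
        have := mul_pos h1 (hS t t0 t1)
        have := mul_pos h2 (hC t t0.le t1)
        rw [← h3] at *
        rw [← h4] at *
        nlinarith)
      rw [intervalIntegral.integral_sub i2 i3, e2, e3] at this
      simp only [hP]
      linarith
    · have := aux_pos_int hab ((i1.add i4).add (i2.sub i3)) (by
        filter_upwards [hall] with t ht hab'
        have t0 : 0 < t := lt_of_le_of_lt ha hab'.1
        have t1 : t ≤ T := hab'.2.trans hb
        obtain ⟨h1, h2, h3, h4⟩ := ht ⟨by linarith, t1⟩
        rw [neg_neg] at h4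
        have := mul_pos h1 (add_pos (hS t t0 t1) (hC t t0.le t1))
        have := mul_nonneg h2.le (sub_nonneg.2 (hCS t t0.le t1))
        rw [← h3] at *
        rw [← h4] at *
        nlinarith)
      rw [intervalIntegral.integral_add (i1.add i4) (i2.sub i3),
        intervalIntegral.integral_add i1 i4, intervalIntegral.integral_sub i2 i3,
        e1, e2, e3, e4] at this
      simp only [hP, hQ]
      linarith
  have h0 : Q 0 - P 0 = 0 := by simp [hP, hQ]
  have hxT : 0 < x T := by
    have := (main 0 T le_rfl hT le_rfl).2
    rw [h0] at this
    simp only [hP, hQ, hper] at this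
    have h2 := hS T hT le_rfl
    by_contra hneg
    nlinarith
  have hPT : 0 ≤ P T := by
    simp only [hP, hper]
    have := mul_nonneg hxT.le (sub_nonneg.2 (hCS T hT.le le_rfl))
    linarith
  have hP0 : ∀ t, 0 ≤ t → t ≤ T → 0 ≤ P t := by
    intro t h1 h2
    rcases h2.eq_or_lt with rfl | h2
    · exact hPT
    · exact hPT.trans (main t T h1 h2 le_rfl).1.le
  have fin : ∀ t, 0 ≤ t → t ≤ T → 0 < x t ∧ 0 < x (-t) := by
    intro t h1 h2
    rcases h1.eq_or_lt with rfl | h1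
    · have := (main 0 T le_rfl hT le_rfl).1
      have h3 : 0 < P 0 := lt_of_le_of_lt hPT this
      simp [hP] at h3
      simpa using h3
    · have h3 := (main 0 t le_rfl h1 h2).2
      rw [h0] at h3
      have hp := hP0 t h1.le h2
      have hs := hS t h1 h2
      have hc := hC t h1.le h2
      have hcs' := hCS t h1.le h2
      have e := Real.sin_sq_add_cos_sq (m * t)
      have ex1 : x t = (Real.cos (m * t) - Real.sin (m * t)) * P t
          + Real.cos (m * t) * (Q t - P t) := by
        simp only [hP, hQ]; linear_combination (- x t) * e
      have ex2 : x (-t) = (Real.cos (m * t) + Real.sin (m * t)) * P t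
          + Real.sin (m * t) * (Q t - P t) := by
        simp only [hP, hQ]; linear_combination (- x (-t)) * e
      constructor
      · rw [ex1]
        exact add_pos_of_nonneg_of_pos (mul_nonneg (sub_nonneg.2 hcs') hp) (mul_pos hc h3)
      · rw [ex2]
        exact add_pos_of_nonneg_of_pos (mul_nonneg (by linarith) hp) (mul_pos hs h3)
  intro t ht
  rcases le_total 0 t with h1 | h1
  · exact (fin t h1 ht.2).1
  · have := (fin (-t) (by linarith) (by linarith [ht.1])).2
    rwa [neg_neg] at this

theorem aux_reflect {T m : ℝ} (hT : 0 < T) {h x : ℝ → ℝ} (hx : IsSol T m h x) :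
    IsSol T (-m) (fun t => h (-t)) (fun t => - x (-t)) := by
  obtain ⟨⟨g, hg, hxg, heq⟩, hper⟩ := hx
  obtain ⟨hg', hxg'⟩ := aux_neg_prim hT hg hxg
  refine ⟨⟨fun t => g (-t), by simpa using hg'.neg, ?_, ?_⟩, ?_⟩
  · intro t ht
    have := hxg' t ht
    rw [intervalIntegral.integral_neg] at this
    simp only
    linarith
  · filter_upwards [aux_neg_ae heq] with t ht
    simp only [neg_neg] at *
    linarith
  · simp [hper]

theorem aux_diff {T m₁ m₂ : ℝ} {h x y : ℝ → ℝ} (hT : 0 < T) (hx : IsSol T m₁ h x)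
    (hy : IsSol T m₂ h y) :
    IsSol T m₁ (fun t => (m₂ - m₁) * y (-t)) (fun t => x t - y t) := by
  obtain ⟨⟨g, hg, hxg, heq⟩, hper⟩ := hx
  obtain ⟨⟨k, hk, hyk, heq'⟩, hper'⟩ := hy
  refine ⟨⟨fun t => g t - k t, hg.sub hk, ?_, ?_⟩, ?_⟩
  · intro t ht
    have hi : ∀ f : ℝ → ℝ, IntegrableOn f (Set.Icc (-T) T) →
        IntervalIntegrable f volume (-T) t := by
      intro f hf
      rw [intervalIntegrable_iff_integrableOn_Icc_of_le ht.1]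
      exact hf.mono_set (Set.Icc_subset_Icc le_rfl ht.2)
    rw [intervalIntegral.integral_sub (hi g hg) (hi k hk)]
    have := hxg t ht
    have := hyk t ht
    linarith
  · filter_upwards [heq, heq'] with t h1 h2
    linarith
  · simp only [hper, hper']

theorem aux_u {T m₁ m₂ : ℝ} (hT : 0 < T) {h u₁ u₂ : ℝ → ℝ}
    (hhpos : ∀ᵐ t ∂(volume.restrict (Set.Icc (-T) T)), 0 < h t)
    (hu₁ : IsSol T m₁ h u₁) (hu₂ : IsSol T m₂ h u₂)
    (h1 : 0 < m₁) (h12 : m₁ < m₂) (h2 : m₂ * T ≤ Real.pi / 4) :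
    ∀ t ∈ Set.Icc (-T) T, u₂ t < u₁ t := by
  have hp := aux_pos hT (h1.trans h12) h2 hhpos hu₂
  have hd := aux_diff hT hu₁ hu₂
  intro t ht
  have := aux_pos hT h1 (by nlinarith) (by
    rw [ae_restrict_iff' measurableSet_Icc]
    refine Filter.Eventually.of_forall fun s hs => ?_
    exact mul_pos (by linarith) (hp _ ⟨by linarith [hs.2], by linarith [hs.1]⟩)) hd t ht
  linarith

theorem aux_anti {p q : ℝ} (hq : -1 ≤ q ∧ q ≤ 1)
    (hpq : (-1 ≤ p ∧ p ≤ 1) ∨ (1 ≤ p ∧ p ≤ 3 ∧ q = -1)) :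
    StrictAntiOn (fun a => (Real.cos (p * a) + Real.sin (q * a)) / (2 * Real.sin a))
      (Set.Ioc 0 (Real.pi / 4)) := by
  have hpi := Real.pi_pos
  have hsin : ∀ a ∈ Set.Ioc (0:ℝ) (Real.pi / 4), 0 < Real.sin a := fun a ha =>
    Real.sin_pos_of_pos_of_lt_pi ha.1 (by linarith [ha.2])
  have hder : ∀ a ∈ Set.Ioc (0:ℝ) (Real.pi / 4),
      HasDerivAt (fun a => (Real.cos (p * a) + Real.sin (q * a)) / (2 * Real.sin a))
      (((-(p * Real.sin (p * a)) + q * Real.cos (q * a)) * (2 * Real.sin a) -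
        (Real.cos (p * a) + Real.sin (q * a)) * (2 * Real.cos a)) / (2 * Real.sin a) ^ 2) a := by
    intro a ha
    have h1 := ((hasDerivAt_id a).const_mul p).cos
    have h2 := ((hasDerivAt_id a).const_mul q).sin
    have h3 := (Real.hasDerivAt_sin a).const_mul 2
    have := (h1.add h2).div h3 (by have := hsin a ha; positivity)
    convert! this using 1
    simp; ring
  refine strictAntiOn_of_deriv_neg (convex_Ioc _ _)
    (fun a ha => (hder a ha).continuousAt.continuousWithinAt) ?_
  intro a ha
  rw [interior_Ioc] at ha
  have ha' : a ∈ Set.Ioc (0:ℝ) (Real.pi / 4) := ⟨ha.1, ha.2.le⟩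
  rw [(hder a ha').deriv]
  have hs := hsin a ha'
  refine div_neg_of_neg_of_pos ?_ (by positivity)
  have h0 : 0 < a := ha.1
  have h4 := ha.2
  have hc : 0 < Real.cos a := Real.cos_pos_of_mem_Ioo ⟨by linarith, by linarith⟩
  suffices hk : q * Real.cos (q * a) * Real.sin a - Real.sin (q * a) * Real.cos a <
      p * Real.sin (p * a) * Real.sin a + Real.cos (p * a) * Real.cos a by linarith
  have hsq := Real.sin_sq_add_cos_sq a
  have hsc : Real.sin a < Real.cos a := by
    rw [← Real.cos_pi_div_two_sub]
    exact Real.cos_lt_cos_of_nonneg_of_le_pi (by linarith) (by linarith) (by linarith)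
  rcases hpq with hp | ⟨hp1, hp3, rfl⟩
  · have hR : Real.cos a * Real.cos a ≤
        p * Real.sin (p * a) * Real.sin a + Real.cos (p * a) * Real.cos a := by
      have e1 : Real.cos a ≤ Real.cos (p * a) := by
        rw [← Real.cos_abs (p * a), abs_mul, abs_of_pos h0]
        have : |p| ≤ 1 := abs_le.2 hp
        exact Real.cos_le_cos_of_nonneg_of_le_pi (by positivity) (by linarith) (by nlinarith)
      have e2 : 0 ≤ p * Real.sin (p * a) := by
        rcases le_total 0 p with h | h
        · exact mul_nonneg h (Real.sin_nonneg_of_nonneg_of_le_pi (by positivity) (by nlinarith))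
        · exact mul_nonneg_of_nonpos_of_nonpos h
            (Real.sin_nonpos_of_nonpos_of_neg_pi_le (by nlinarith) (by nlinarith))
      have := mul_nonneg e2 hs.le
      have := mul_le_mul_of_nonneg_right e1 hc.le
      linarith
    refine lt_of_lt_of_le ?_ hR
    rcases le_total 0 q with h | h
    · have e1 : q * Real.sin a ≤ Real.sin (q * a) := by
        have := strictConcaveOn_sin_Icc.concaveOn.2 (⟨le_rfl, hpi.le⟩ : (0:ℝ) ∈ Set.Icc 0 Real.pi)
          (⟨h0.le, by linarith⟩ : a ∈ Set.Icc 0 Real.pi)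
          (by linarith [hq.2] : (0:ℝ) ≤ 1 - q) h (by ring)
        simpa using this
      have e2 : Real.cos (q * a) ≤ 1 := Real.cos_le_one _
      have e3 : Real.cos a ≤ Real.cos (q * a) :=
        Real.cos_le_cos_of_nonneg_of_le_pi (by positivity) (by linarith) (by nlinarith [hq.2])
      have e4 : 1 / 2 < Real.cos a := by nlinarith
      have f1 := mul_le_mul_of_nonneg_right e1 hc.le
      have f2 : q * Real.sin a * (Real.cos (q * a) - Real.cos a) ≤
          Real.sin a * (1 - Real.cos a) :=
        mul_le_mul (by nlinarith [hq.2]) (by linarith) (by linarith) hs.le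
      nlinarith
    · have e1 : -Real.sin (q * a) ≤ Real.sin a := by
        rw [← Real.sin_neg]
        exact Real.sin_le_sin_of_le_of_le_pi_div_two (by nlinarith) (by linarith)
          (by nlinarith [hq.1])
      have e3 : 0 < Real.cos (q * a) :=
        Real.cos_pos_of_mem_Ioo ⟨by nlinarith [hq.1], by nlinarith⟩
      have f1 : q * Real.cos (q * a) * Real.sin a ≤ 0 :=
        mul_nonpos_of_nonpos_of_nonneg (mul_nonpos_of_nonpos_of_nonneg h e3.le) hs.le
      have f2 := mul_le_mul_of_nonneg_right e1 hc.le
      have f3 := mul_lt_mul_of_pos_right hsc hc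
      linarith
  · have e1 : 0 < Real.sin (p * a) :=
      Real.sin_pos_of_pos_of_lt_pi (by nlinarith) (by nlinarith)
    have e2 : 0 < Real.cos (p * a - a) :=
      Real.cos_pos_of_mem_Ioo ⟨by nlinarith, by nlinarith⟩
    rw [Real.cos_sub] at e2
    have e3 : 0 ≤ (p - 1) * (Real.sin (p * a) * Real.sin a) :=
      mul_nonneg (by linarith) (by positivity)
    simp only [neg_mul, one_mul, Real.cos_neg, Real.sin_neg]
    nlinarith

theorem aux_G {T m₁ m₂ : ℝ} (hT : 0 < T)
    (h1 : 0 < m₁) (h12 : m₁ < m₂) (h2 : m₂ * T ≤ Real.pi / 4) (t s : ℝ)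
    (ht : t ∈ Set.Icc (-T) T) (hs : s ∈ Set.Icc (-T) T) :
    Gbar T m₂ t s < Gbar T m₁ t s := by
  have key : ∀ P Q : ℝ, (-T ≤ Q ∧ Q ≤ T) →
      ((-T ≤ P ∧ P ≤ T) ∨ (T ≤ P ∧ P ≤ 3 * T ∧ Q = -T)) →
      (Real.cos (m₂ * P) + Real.sin (m₂ * Q)) / (2 * Real.sin (m₂ * T)) <
      (Real.cos (m₁ * P) + Real.sin (m₁ * Q)) / (2 * Real.sin (m₁ * T)) := by
    intro P Q hQ hP
    have hh := aux_anti (p := P / T) (q := Q / T)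
      ⟨by rw [le_div_iff₀ hT]; linarith, by rw [div_le_iff₀ hT]; linarith⟩
      (by
        rcases hP with hP | ⟨a, b, c⟩
        · left
          exact ⟨by rw [le_div_iff₀ hT]; linarith, by rw [div_le_iff₀ hT]; linarith⟩
        · right
          refine ⟨by rw [le_div_iff₀ hT]; linarith, by rw [div_le_iff₀ hT]; linarith, ?_⟩
          rw [c]; field_simp)
    have := hh (a := m₁ * T) (b := m₂ * T) ⟨by positivity, by nlinarith⟩
      ⟨mul_pos (h1.trans h12) hT, h2⟩ (by nlinarith)
    have e : ∀ P m : ℝ, P / T * (m * T) = m * P := by intro P m; field_simp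
    simpa only [e] using this
  have key' : ∀ P Q : ℝ, (-T ≤ Q ∧ Q ≤ T) →
      ((-T ≤ P ∧ P ≤ T) ∨ (T ≤ P ∧ P ≤ 3 * T ∧ Q = T)) →
      (Real.cos (m₂ * P) - Real.sin (m₂ * Q)) / (2 * Real.sin (m₂ * T)) <
      (Real.cos (m₁ * P) - Real.sin (m₁ * Q)) / (2 * Real.sin (m₁ * T)) := by
    intro P Q hQ hP
    have := key P (-Q) ⟨by linarith, by linarith⟩ (by
      rcases hP with hP | ⟨a, b, c⟩
      · exact Or.inl hP
      · exact Or.inr ⟨a, b, by rw [c]⟩)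
    simpa only [mul_neg, Real.sin_neg, ← sub_eq_add_neg] using this
  obtain ⟨t1, t2⟩ := ht
  obtain ⟨s1, s2⟩ := hs
  unfold Gbar
  rw [if_pos h1, if_pos (h1.trans h12)]
  split_ifs with c1 c2 c3 c4
  · exact key _ _ ⟨by linarith, by linarith⟩ (Or.inl ⟨by linarith, by linarith⟩)
  · exact key' _ _ ⟨by linarith, by linarith⟩ (Or.inl ⟨by linarith, by linarith⟩)
  · have := neg_abs_le t
    have := le_abs_self t
    exact key _ _ ⟨by linarith, by linarith⟩ (Or.inl ⟨by linarith, by linarith⟩)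
  · have := neg_abs_le s
    have := le_abs_self s
    exact key' _ _ ⟨by linarith, by linarith⟩ (Or.inl ⟨by linarith, by linarith⟩)
  · refine key' _ _ ⟨by linarith, le_rfl⟩ ?_
    rcases le_total 0 t with h | h
    · exact Or.inl ⟨by linarith, by linarith⟩
    · exact Or.inr ⟨by linarith, by linarith, rfl⟩

theorem aux_Gneg {T m : ℝ} (hm : m < 0) (t s : ℝ) : Gbar T m t s = - Gbar T (-m) s t := by
  have hm' : 0 < -m := by linarith
  have hdiag : ¬ (-t ≤ s ∧ s < t) → ¬ (-s ≤ t ∧ t < s) → ¬ (s < -|t|) → ¬ (t < -|s|) → t = s := by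
    intro a b c d
    rcases abs_cases t with h | h <;> rcases abs_cases s with h' | h' <;> grind
  unfold Gbar
  rw [if_pos hm', if_neg (not_lt.2 hm.le)]
  have e : 2 * Real.sin (-m * T) = -(2 * Real.sin (m * T)) := by
    rw [neg_mul, Real.sin_neg]; ring
  rw [e, div_neg, neg_neg]
  congr 1
  have ex12 : (-t ≤ s ∧ s < t) → ¬ (-s ≤ t ∧ t < s) := fun a b => by linarith [a.2, b.2]
  have ex13 : (-t ≤ s ∧ s < t) → ¬ (t < -|s|) := fun a b => by
    have := neg_abs_le s; linarith [a.2]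
  have ex34 : s < -|t| → ¬ (t < -|s|) := fun a b => by
    have := neg_abs_le s; have := neg_abs_le t; linarith
  by_cases c1 : -t ≤ s ∧ s < t
  · rw [if_pos c1, if_neg (ex12 c1), if_pos c1]
    simp only [neg_mul, Real.cos_neg, Real.sin_neg, sub_neg_eq_add]
    congr 2 <;> ring
  rw [if_neg c1]
  by_cases c2 : -s ≤ t ∧ t < s
  · rw [if_pos c2, if_pos c2]
    simp only [neg_mul, Real.cos_neg, Real.sin_neg, sub_eq_add_neg]
    congr 2 <;> ring_nf
  rw [if_neg c2, if_neg c2, if_neg c1]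
  by_cases c3 : s < -|t|
  · rw [if_pos c3, if_neg (ex34 c3), if_pos c3]
    simp only [neg_mul, Real.cos_neg, Real.sin_neg, sub_neg_eq_add]
    congr 2 <;> ring_nf
  rw [if_neg c3]
  by_cases c4 : t < -|s|
  · rw [if_pos c4, if_pos c4]
    simp only [neg_mul, Real.cos_neg, Real.sin_neg, sub_eq_add_neg]
    congr 2 <;> ring_nf
  rw [if_neg c4, if_neg c4, if_neg c3, hdiag c1 c2 c3 c4]
  simp only [neg_mul, Real.cos_neg, Real.sin_neg, sub_neg_eq_add]

/-- Let `h > 0` a.e. on `I` be integrable and, for `i = 1,2`, let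
`u_i` solve `x'(t) + m_i·x(−t) = h(t)` a.e. with `x(−T) = x(T)`.  Then:
(1) if `0 < m₁ < m₂ ≤ π/(4T)` then `u₁ > u₂` on `I` and `Ḡ_{m₁} > Ḡ_{m₂}` on `I²`;
(2) if `−π/(4T) ≤ m₁ < m₂ < 0` then `u₁ > u₂` on `I` and `Ḡ_{m₁} > Ḡ_{m₂}` on `I²`. -/
theorem stmt_16 (T m₁ m₂ : ℝ) (hT : 0 < T)
    (h u₁ u₂ : ℝ → ℝ)
    (hh : IntegrableOn h (Set.Icc (-T) T))
    (hhpos : ∀ᵐ t ∂(volume.restrict (Set.Icc (-T) T)), 0 < h t)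
    (hu₁ : IsSol T m₁ h u₁) (hu₂ : IsSol T m₂ h u₂) :
    (0 < m₁ ∧ m₁ < m₂ ∧ m₂ ≤ Real.pi / (4 * T) →
      (∀ t ∈ Set.Icc (-T) T, u₂ t < u₁ t) ∧
      (∀ t ∈ Set.Icc (-T) T, ∀ s ∈ Set.Icc (-T) T,
        Gbar T m₂ t s < Gbar T m₁ t s)) ∧
    (-(Real.pi / (4 * T)) ≤ m₁ ∧ m₁ < m₂ ∧ m₂ < 0 →
      (∀ t ∈ Set.Icc (-T) T, u₂ t < u₁ t) ∧
      (∀ t ∈ Set.Icc (-T) T, ∀ s ∈ Set.Icc (-T) T,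
        Gbar T m₂ t s < Gbar T m₁ t s)) := by
  have conv : ∀ m : ℝ, m ≤ Real.pi / (4 * T) → m * T ≤ Real.pi / 4 := by
    intro m hm
    have := mul_le_mul_of_nonneg_right hm hT.le
    have e : Real.pi / (4 * T) * T = Real.pi / 4 := by field_simp
    linarith
  constructor
  · rintro ⟨h1, h12, h2⟩
    exact ⟨aux_u hT hhpos hu₁ hu₂ h1 h12 (conv _ h2),
      fun t ht s hs => aux_G hT h1 h12 (conv _ h2) t s ht hs⟩
  · rintro ⟨h1, h12, h2⟩
    have hb := conv (-m₁) (by linarith)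
    constructor
    · intro t ht
      have := aux_u hT (aux_neg_ae (p := fun t => 0 < h t) hhpos) (aux_reflect hT hu₂) (aux_reflect hT hu₁)
        (by linarith) (by linarith) hb (-t) ⟨by linarith [ht.2], by linarith [ht.1]⟩
      simp only [neg_neg] at this
      linarith
    · intro t ht s hs
      rw [aux_Gneg h2, aux_Gneg (h12.trans h2)]
      have := aux_G (m₁ := -m₂) (m₂ := -m₁) hT (by linarith) (by linarith) hb s t hs ht
      linarith
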